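/- Let α ∈ ℂ with Re α ≥ 0 and let φ be analytic on the unit disk with φ(0) = 1 and convex image, symmetric with respect to the real axis with Taylor coefficients B_n satisfying B_1 > 0. If f(z) = z + ∑_{n≥2} a_n z^n satisfies f'(z) + α z f''(z) ≺ φ(z), then f(z)/z ≺ ∫₀¹∫₀¹ φ(z σ ζ^α) dσ dζ, and the double integral equals 1 + ∑_{n≥1} B_n z^n / ((n+1)(1 + nα)) when α is real. -/

import Mathlib

open Metric

section ConvexSubordination

open Set Filter Topology

theorem exists_leftInverse_hasDerivAt_of_injOn {f : ℂ → ℂ} {U : Set ℂ} (hU : IsOpen U)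
    (hUc : IsPreconnected U) (hf : DifferentiableOn ℂ f U) (hinj : InjOn f U) :
    (∀ s ⊆ U, IsOpen s → IsOpen (f '' s)) ∧ ∃ ψ : ℂ → ℂ, ∀ z ∈ U, ψ (f z) = z ∧
      deriv f z ≠ 0 ∧ HasDerivAt ψ (deriv f z)⁻¹ (f z) := by
  have hlocal : ∀ z ∈ U, ∀ V ∈ 𝓝 z, ∃ x ∈ U ∩ V, x ≠ z := fun z hz V hV => by
    have h1 : ∀ᶠ x in 𝓝[≠] z, x ∈ U ∩ V :=
      nhdsWithin_le_nhds (inter_mem (hU.mem_nhds hz) hV)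
    obtain ⟨x, hx, hne⟩ := (h1.and self_mem_nhdsWithin).exists
    exact ⟨x, hx, hne⟩
  have hopen : ∀ s ⊆ U, IsOpen s → IsOpen (f '' s) := by
    rcases (hf.analyticOnNhd hU).is_constant_or_isOpen hUc with ⟨w, hw⟩ | h
    · intro s hs _
      suffices s = ∅ by simp [this]
      refine eq_empty_of_forall_notMem fun z hz => ?_
      obtain ⟨x, hx, hne⟩ := hlocal z (hs hz) univ univ_mem
      exact hne (hinj hx.1 (hs hz) ((hw x hx.1).trans (hw z (hs hz)).symm))
    · exact h
  set ψ := Function.invFunOn f U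
  have hψ : ∀ z ∈ U, ψ (f z) = z := hinj.leftInvOn_invFunOn
  have hev : ∀ z ∈ U, ∀ p : ℂ → Prop, (∀ᶠ x in 𝓝 z, p x) →
      ∀ᶠ y in 𝓝 (f z), ∃ x ∈ U, p x ∧ f x = y := by
    intro z hz p hp
    obtain ⟨V, hVp, hVo, hzV⟩ := _root_.mem_nhds_iff.1 (inter_mem hp (hU.mem_nhds hz))
    filter_upwards [(hopen V (fun x hx => (hVp hx).2) hVo).mem_nhds (mem_image_of_mem f hzV)]
    rintro _ ⟨x, hx, rfl⟩
    exact ⟨x, (hVp hx).2, (hVp hx).1, rfl⟩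
  have hcont : ∀ z ∈ U, ContinuousAt ψ (f z) := by
    intro z hz
    rw [ContinuousAt, hψ z hz]
    intro V hV
    rw [mem_map]
    filter_upwards [hev z hz (· ∈ V) hV]
    rintro _ ⟨x, hxU, hxV, rfl⟩
    rwa [mem_preimage, hψ x hxU]
  have hfd : ∀ z ∈ U, HasDerivAt f (deriv f z) z := fun z hz =>
    (hf.differentiableAt (hU.mem_nhds hz)).hasDerivAt
  have hreg : ∀ z ∈ U, deriv f z ≠ 0 → HasDerivAt ψ (deriv f z)⁻¹ (f z) := by
    intro z hz h0
    refine HasDerivAt.of_local_left_inverse (hcont z hz) (f := f) ?_ h0 ?_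
    · rw [hψ z hz]; exact hfd z hz
    · filter_upwards [hev z hz (fun _ => True) (by simp)]
      rintro _ ⟨x, hxU, -, rfl⟩
      rw [hψ x hxU]
  have hne : ∀ z ∈ U, deriv f z ≠ 0 := by
    intro z hz
    have han : AnalyticAt ℂ (deriv f) z := (hf.analyticOnNhd hU z hz).deriv
    have hpunct : ∀ᶠ x in 𝓝[≠] z, deriv f x ≠ 0 := by
      refine han.eventually_eq_zero_or_eventually_ne_zero.resolve_left fun h0 => ?_
      obtain ⟨ε, hε, hb⟩ := Metric.mem_nhds_iff.1 (inter_mem h0 (hU.mem_nhds hz))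
      obtain ⟨x, hx, hxz⟩ := hlocal z hz _ (ball_mem_nhds z hε)
      refine hxz (hinj hx.1 hz ?_)
      exact isOpen_ball.is_const_of_deriv_eq_zero (convex_ball z ε).isPreconnected
        (hf.mono fun y hy => (hb hy).2) (fun y hy => (hb hy).1) hx.2 (mem_ball_self hε)
    have hdiff : ∀ᶠ y in 𝓝[≠] (f z), DifferentiableAt ℂ ψ y := by
      rw [eventually_nhdsWithin_iff] at hpunct ⊢
      filter_upwards [hev z hz _ hpunct]
      rintro _ ⟨x, hxU, hx, rfl⟩ hxz
      exact (hreg x hxU (hx fun h => hxz (by rw [h]; rfl))).differentiableAt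
    have hd := (Complex.analyticAt_of_differentiable_on_punctured_nhds_of_continuousAt hdiff
      (hcont z hz)).differentiableAt.hasDerivAt
    have h1 : HasDerivAt (ψ ∘ f) 1 z := (hasDerivAt_id z).congr_of_eventuallyEq <| by
      filter_upwards [hU.mem_nhds hz] with x hx using hψ x hx
    intro h0
    have h2 := (hd.comp z (hfd z hz)).unique h1
    simp [h0] at h2
  exact ⟨hopen, ψ, fun z hz => ⟨hψ z hz, hne z hz, hreg z hz (hne z hz)⟩⟩

/-- The analytic description of the locally univalent convex functions on the unit disc. -/
structure IsConvexOnDisc (h : ℂ → ℂ) : Prop where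
  differentiableOn : DifferentiableOn ℂ h (ball 0 1)
  deriv_ne_zero : ∀ z ∈ ball (0 : ℂ) 1, deriv h z ≠ 0
  re_pos : ∀ z ∈ ball (0 : ℂ) 1, 0 < (1 + z * deriv (deriv h) z / deriv h z).re

theorem hasDerivAt_of_differentiableOn_ball {h : ℂ → ℂ} (hh : DifferentiableOn ℂ h (ball 0 1))
    {z : ℂ} (hz : z ∈ ball (0 : ℂ) 1) : HasDerivAt h (deriv h z) z :=
  (hh.differentiableAt (isOpen_ball.mem_nhds hz)).hasDerivAt

theorem hasDerivAt_deriv_of_differentiableOn_ball {h : ℂ → ℂ}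
    (hh : DifferentiableOn ℂ h (ball 0 1)) {z : ℂ} (hz : z ∈ ball (0 : ℂ) 1) :
    HasDerivAt (deriv h) (deriv (deriv h) z) z :=
  hasDerivAt_of_differentiableOn_ball (hh.deriv isOpen_ball) hz

theorem re_nonpos_of_hasDerivAt {c : ℝ → ℂ} {c' : ℂ} (h : HasDerivAt c c' 0)
    (hle : ∀ᶠ t in 𝓝[>] (0 : ℝ), (c t).re ≤ (c 0).re) : c'.re ≤ 0 := by
  have h1 := (Complex.reCLM.hasFDerivAt.comp_hasDerivAt (0 : ℝ) h).tendsto_slope_zero_right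
  refine le_of_tendsto h1 ?_
  filter_upwards [hle, self_mem_nhdsWithin] with t ht ht0
  simp only [zero_add, Function.comp_apply, Complex.reCLM_apply, smul_eq_mul]
  exact mul_nonpos_of_nonneg_of_nonpos (inv_nonneg.2 (le_of_lt ht0)) (sub_nonpos.2 ht)

theorem hasDerivAt_comp_mul_exp {g : ℂ → ℂ} {z g' : ℂ} {θ : ℝ}
    (hg : HasDerivAt g g' (z * Complex.exp (θ * Complex.I))) :
    HasDerivAt (fun θ : ℝ => g (z * Complex.exp (θ * Complex.I)))
      (g' * (z * Complex.exp (θ * Complex.I) * Complex.I)) θ := by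
  have h1 : HasDerivAt (fun w : ℂ => z * Complex.exp (w * Complex.I))
      (z * Complex.exp (θ * Complex.I) * Complex.I) θ := by
    simpa [mul_assoc] using (((hasDerivAt_id (θ : ℂ)).mul_const Complex.I).cexp).const_mul z
  exact (hg.comp (θ : ℂ) h1).comp_ofReal

theorem mul_exp_mem_ball {z : ℂ} (hz : z ∈ ball (0 : ℂ) 1) (θ : ℝ) :
    z * Complex.exp (θ * Complex.I) ∈ ball (0 : ℂ) 1 := by
  rw [mem_ball_zero_iff] at hz ⊢
  rwa [norm_mul, Complex.norm_exp_ofReal_mul_I, mul_one]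

theorem re_le_zero_of_convex_image {φ : ℂ → ℂ} (hφ : DifferentiableOn ℂ φ (ball 0 1))
    (hconv : Convex ℝ (φ '' ball 0 1)) (hinj : InjOn φ (ball 0 1)) {z₁ z₂ : ℂ}
    (hz : ‖z₁‖ ≤ ‖z₂‖) (hz₂ : z₂ ∈ ball (0 : ℂ) 1) :
    ((φ z₁ - φ z₂) / (z₂ * deriv φ z₂)).re ≤ 0 := by
  obtain ⟨-, ψ, hψ⟩ := exists_leftInverse_hasDerivAt_of_injOn isOpen_ball
    (convex_ball (0 : ℂ) 1).isPreconnected hφ hinj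
  rcases eq_or_ne z₂ 0 with rfl | h0
  · simp
  have hd := (hψ z₂ hz₂).2.1
  have hquot : ‖z₁ / z₂‖ ≤ 1 := by
    rw [norm_div]; exact div_le_one_of_le₀ hz (norm_nonneg _)
  have hmaps : ∀ z ∈ ball (0 : ℂ) 1, z * (z₁ / z₂) ∈ ball (0 : ℂ) 1 := by
    intro z hz
    rw [mem_ball_zero_iff] at hz ⊢
    rw [norm_mul]
    exact (mul_le_of_le_one_right (norm_nonneg _) hquot).trans_lt hz
  have key : ∀ t ∈ Icc (0 : ℝ) 1, ‖ψ (φ z₂ + t * (φ z₁ - φ z₂))‖ ≤ ‖z₂‖ := by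
    intro t ht
    let g : ℂ → ℂ := fun z => φ z + t * (φ (z * (z₁ / z₂)) - φ z)
    have hg : ∀ z ∈ ball (0 : ℂ) 1, ∃ x ∈ ball (0 : ℂ) 1, φ x = g z := by
      intro z hz
      have := hconv (mem_image_of_mem φ hz) (mem_image_of_mem φ (hmaps z hz))
        (sub_nonneg.2 ht.2) ht.1 (by ring)
      obtain ⟨x, hx, hxe⟩ := this
      refine ⟨x, hx, hxe.trans ?_⟩
      simp only [g, Complex.real_smul]
      push_cast
      ring
    have hgd : DifferentiableOn ℂ g (ball 0 1) := by
      have : DifferentiableOn ℂ (fun z => φ (z * (z₁ / z₂))) (ball 0 1) :=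
        hφ.comp (by fun_prop) hmaps
      exact hφ.add ((this.sub hφ).const_mul _)
    have := Complex.norm_le_norm_of_mapsTo_ball (f := ψ ∘ g) (R := 1) (z := z₂) ?_ ?_ ?_
      (by simpa using hz₂)
    · simpa [g, mul_div_cancel₀ _ h0] using this
    · intro z hz
      obtain ⟨x, hx, hxe⟩ := hg z hz
      have h1 := (hψ x hx).2.2.differentiableAt
      rw [hxe] at h1
      exact (h1.comp z (hgd.differentiableAt (isOpen_ball.mem_nhds hz))).differentiableWithinAt
    · intro z hz
      obtain ⟨x, hx, hxe⟩ := hg z hz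
      rw [Function.comp_apply, ← hxe, (hψ x hx).1]
      exact ball_subset_closedBall hx
    · simpa [g] using (hψ 0 (by simp)).1
  have hline : HasDerivAt (fun t : ℝ => φ z₂ + t * (φ z₁ - φ z₂)) (φ z₁ - φ z₂) 0 := by
    simpa using ((Complex.ofRealCLM.hasDerivAt (x := (0 : ℝ))).mul_const
      (φ z₁ - φ z₂)).const_add (φ z₂)
  have hcurve : HasDerivAt (fun t : ℝ => ψ (φ z₂ + t * (φ z₁ - φ z₂)) / z₂)
      ((deriv φ z₂)⁻¹ * (φ z₁ - φ z₂) / z₂) 0 := by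
    have h1 := (hψ z₂ hz₂).2.2
    have h2 : φ z₂ = φ z₂ + ((0 : ℝ) : ℂ) * (φ z₁ - φ z₂) := by simp
    rw [h2] at h1
    exact (h1.comp (0 : ℝ) hline).div_const z₂
  have h0' : ψ (φ z₂ + ((0 : ℝ) : ℂ) * (φ z₁ - φ z₂)) / z₂ = 1 := by
    simp [(hψ z₂ hz₂).1, h0]
  have hre := re_nonpos_of_hasDerivAt hcurve ?_
  · rwa [show (φ z₁ - φ z₂) / (z₂ * deriv φ z₂) = (deriv φ z₂)⁻¹ * (φ z₁ - φ z₂) / z₂ by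
      field_simp]
  · filter_upwards [Ioo_mem_nhdsGT (zero_lt_one' ℝ)] with t ht
    rw [h0', Complex.one_re]
    refine (Complex.re_le_norm _).trans ?_
    rw [norm_div]
    exact div_le_one_of_le₀ (key t ⟨ht.1.le, ht.2.le⟩) (norm_nonneg _)

theorem isConvexOnDisc_of_convex_image {φ : ℂ → ℂ} (hφ : DifferentiableOn ℂ φ (ball 0 1))
    (hconv : Convex ℝ (φ '' ball 0 1)) (hinj : InjOn φ (ball 0 1)) : IsConvexOnDisc φ := by
  obtain ⟨-, ψ, hψ⟩ := exists_leftInverse_hasDerivAt_of_injOn isOpen_ball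
    (convex_ball (0 : ℂ) 1).isPreconnected hφ hinj
  have hne : ∀ z ∈ ball (0 : ℂ) 1, deriv φ z ≠ 0 := fun z hz => (hψ z hz).2.1
  have hnonneg : ∀ z ∈ ball (0 : ℂ) 1, 0 ≤ (1 + z * deriv (deriv φ) z / deriv φ z).re := by
    intro z hz
    rcases eq_or_ne z 0 with rfl | h0
    · simp
    by_contra! hneg
    let u : ℝ → ℝ := fun θ =>
      ((φ (z * Complex.exp (θ * Complex.I)) - φ z) / (z * deriv φ z)).re
    let v : ℝ → ℝ := fun θ => (deriv φ (z * Complex.exp (θ * Complex.I)) *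
      (z * Complex.exp (θ * Complex.I) * Complex.I) / (z * deriv φ z)).re
    have hu : ∀ θ, HasDerivAt u (v θ) θ := fun θ =>
      Complex.reCLM.hasFDerivAt.comp_hasDerivAt θ (((hasDerivAt_comp_mul_exp
        (hasDerivAt_of_differentiableOn_ball hφ (mul_exp_mem_ball hz θ))).sub_const _).div_const _)
    have hv : HasDerivAt v (-(1 + z * deriv (deriv φ) z / deriv φ z).re) 0 := by
      have h1 : HasDerivAt (fun x => deriv φ x * (x * Complex.I) / (z * deriv φ z))
          ((deriv (deriv φ) z * (z * Complex.I) + deriv φ z * Complex.I) / (z * deriv φ z))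
          (z * Complex.exp ((0 : ℝ) * Complex.I)) := by
        have := (hasDerivAt_deriv_of_differentiableOn_ball hφ hz).mul
          ((hasDerivAt_id z).mul_const Complex.I)
        simpa using this.div_const (z * deriv φ z)
      have h2 := Complex.reCLM.hasFDerivAt.comp_hasDerivAt (0 : ℝ) (hasDerivAt_comp_mul_exp h1)
      refine h2.congr_deriv ?_
      rw [← Complex.neg_re, Complex.reCLM_apply]
      congr 1
      have := hne z hz
      simp only [Complex.ofReal_zero, zero_mul, Complex.exp_zero, mul_one]
      field_simp
      linear_combination (z * deriv (deriv φ) z + deriv φ z) * Complex.I_sq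
    have hdu : deriv u = v := funext fun θ => (hu θ).deriv
    have hmax : ∀ θ, u θ ≤ u 0 := by
      intro θ
      have : u 0 = 0 := by simp [u]
      rw [this]
      exact re_le_zero_of_convex_image hφ hconv hinj
        (by rw [norm_mul, Complex.norm_exp_ofReal_mul_I, mul_one]) hz
    have hv0 : v 0 = 0 := IsLocalMax.hasDerivAt_eq_zero (Eventually.of_forall hmax) (hu 0)
    have hmin : IsLocalMin u 0 := isLocalMin_of_deriv_deriv_pos (by rw [hdu, hv.deriv]; linarith)
      (by rw [hdu, hv0]) (hu 0).continuousAt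
    have hconst : u =ᶠ[𝓝 0] fun _ => u 0 := by
      filter_upwards [hmin] with θ hθ using le_antisymm (hmax θ) hθ
    have hvz : v =ᶠ[𝓝 0] fun _ => 0 := by
      have := hconst.deriv
      rwa [hdu, deriv_const'] at this
    have := hv.unique ((hasDerivAt_const (0 : ℝ) (0 : ℝ)).congr_of_eventuallyEq hvz)
    linarith
  refine ⟨hφ, hne, fun z hz => (hnonneg z hz).lt_of_ne' fun h0 => ?_⟩
  let E : ℂ → ℂ := fun z => Complex.exp (-(1 + z * deriv (deriv φ) z / deriv φ z))
  have hE : DifferentiableOn ℂ E (ball 0 1) := by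
    have h1 := hφ.deriv isOpen_ball
    exact (((differentiableOn_id.mul (h1.deriv isOpen_ball)).div h1 hne).const_add 1).neg.cexp
  have hEn : ∀ x, ‖E x‖ = Real.exp (-(1 + x * deriv (deriv φ) x / deriv φ x).re) := fun x => by
    rw [Complex.norm_exp, Complex.neg_re]
  have := Complex.norm_eqOn_of_isPreconnected_of_isMaxOn (convex_ball (0 : ℂ) 1).isPreconnected
    isOpen_ball hE hz (fun x hx => by
      change ‖E x‖ ≤ ‖E z‖
      rw [hEn, hEn, h0, neg_zero]
      exact Real.exp_le_exp.2 (neg_nonpos.2 (hnonneg x hx))) (mem_ball_self zero_lt_one)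
  simp [hEn, h0] at this

namespace IsConvexOnDisc

variable {q : ℂ → ℂ}

theorem differentiableOn_curvature (hq : IsConvexOnDisc q) :
    DifferentiableOn ℂ (fun x => 1 + x * deriv (deriv q) x / deriv q x) (ball 0 1) := by
  have h1 := hq.differentiableOn.deriv isOpen_ball
  exact ((differentiableOn_id.mul (h1.deriv isOpen_ball)).div h1 hq.deriv_ne_zero).const_add 1

theorem exists_argument (hq : IsConvexOnDisc q) {z : ℂ} (hz : z ∈ ball (0 : ℂ) 1) :
    ∃ I : ℝ → ℂ, I 0 = 0 ∧ I (2 * Real.pi) = 2 * Real.pi ∧ StrictMono (fun θ => (I θ).re) ∧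
      ∀ θ : ℝ, Complex.exp (θ * Complex.I) * deriv q (z * Complex.exp (θ * Complex.I)) =
        deriv q z * Complex.exp (I θ * Complex.I) := by
  set P : ℂ → ℂ := fun x => 1 + x * deriv (deriv q) x / deriv q x with hP
  have hPd : DifferentiableOn ℂ P (ball 0 1) := hq.differentiableOn_curvature
  have hPc : Continuous fun θ : ℝ => P (z * Complex.exp (θ * Complex.I)) :=
    hPd.continuousOn.comp_continuous (by fun_prop) (mul_exp_mem_ball hz)
  let I : ℝ → ℂ := fun θ => ∫ t in (0 : ℝ)..θ, P (z * Complex.exp (t * Complex.I))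
  have hI : ∀ θ : ℝ, HasDerivAt I (P (z * Complex.exp ((θ : ℝ) * Complex.I))) θ := fun θ =>
    intervalIntegral.integral_hasDerivAt_right (hPc.intervalIntegrable _ _)
      (hPc.stronglyMeasurableAtFilter _ _) hPc.continuousAt
  have hI0 : I 0 = 0 := intervalIntegral.integral_same
  refine ⟨I, hI0, ?_, ?_, ?_⟩
  · have hmaps : MapsTo (fun x => z * x) (closedBall 0 1) (ball (0 : ℂ) 1) := fun x hx => by
      rw [mem_ball_zero_iff] at hz ⊢
      rw [mem_closedBall_zero_iff] at hx
      rw [norm_mul]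
      exact (mul_le_of_le_one_right (norm_nonneg _) hx).trans_lt hz
    have hopen : IsOpen ((fun x => z * x) ⁻¹' ball (0 : ℂ) 1) :=
      isOpen_ball.preimage (by fun_prop)
    have hd : DifferentiableOn ℂ (fun x => P (z * x)) ((fun x => z * x) ⁻¹' ball (0 : ℂ) 1) :=
      hPd.comp (by fun_prop) (mapsTo_preimage _ _)
    have h1 : DiffContOnCl ℂ (fun x => P (z * x)) (ball 0 |1|) := by
      rw [abs_one]
      exact hd.diffContOnCl_ball hmaps
    have h2 := h1.circleAverage
    rw [Real.circleAverage_def] at h2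
    have h3 : I (2 * Real.pi) = (2 * Real.pi) • P (z * 0) := by
      rw [← h2, smul_smul, mul_inv_cancel₀ (by positivity), one_smul]
      simp [I, circleMap]
    rw [h3]
    simp [hP]
  · refine strictMono_of_hasDerivAt_pos (f' := fun θ =>
      (P (z * Complex.exp (θ * Complex.I))).re) (fun θ => ?_) fun θ => ?_
    · exact Complex.reCLM.hasFDerivAt.comp_hasDerivAt θ (hI θ)
    · exact hq.re_pos _ (mul_exp_mem_ball hz θ)
  · set F : ℝ → ℂ := fun θ => Complex.exp (θ * Complex.I) *
      deriv q (z * Complex.exp (θ * Complex.I)) * Complex.exp (-(I θ * Complex.I)) with hF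
    have hFd : ∀ θ, HasDerivAt F 0 θ := by
      intro θ
      have h1 : HasDerivAt (fun θ : ℝ => Complex.exp (θ * Complex.I))
          (Complex.exp (θ * Complex.I) * Complex.I) θ := by
        simpa using (((hasDerivAt_id (θ : ℂ)).mul_const Complex.I).cexp).comp_ofReal
      have h2 := hasDerivAt_comp_mul_exp
        (hasDerivAt_deriv_of_differentiableOn_ball hq.differentiableOn (mul_exp_mem_ball hz θ))
      have h3 := ((hI θ).mul_const Complex.I).neg.cexp
      refine ((h1.mul h2).mul h3).congr_deriv ?_
      have := hq.deriv_ne_zero _ (mul_exp_mem_ball hz θ)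
      simp only [hP, Pi.mul_apply, Pi.neg_apply]
      generalize deriv q (z * Complex.exp (θ * Complex.I)) = d at this ⊢
      field_simp
      ring
    intro θ
    have hc := is_const_of_deriv_eq_zero (fun θ => (hFd θ).differentiableAt)
      (fun θ => (hFd θ).deriv) θ 0
    simp only [hF, hI0, Complex.exp_neg, Complex.ofReal_zero, zero_mul, Complex.exp_zero,
      one_mul, mul_one, inv_one] at hc
    rw [← hc, inv_mul_cancel_right₀ (Complex.exp_ne_zero _)]

theorem re_neg_of_circle (hq : IsConvexOnDisc q) {z : ℂ} (hz : z ∈ ball (0 : ℂ) 1) (h0 : z ≠ 0)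
    {θ : ℝ} (hθ : θ ∈ Ioo 0 (2 * Real.pi)) :
    ((q (z * Complex.exp (θ * Complex.I)) - q z) / (z * deriv q z)).re < 0 := by
  obtain ⟨I, hI0, hI2, hmono, hI⟩ := hq.exists_argument hz
  let u : ℝ → ℝ := fun θ => ((q (z * Complex.exp (θ * Complex.I)) - q z) / (z * deriv q z)).re
  have hu : ∀ θ, HasDerivAt u (-(Real.exp (-(I θ).im) * Real.sin (I θ).re)) θ := by
    intro θ
    refine (Complex.reCLM.hasFDerivAt.comp_hasDerivAt θ (((hasDerivAt_comp_mul_exp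
        (hasDerivAt_of_differentiableOn_ball hq.differentiableOn
          (mul_exp_mem_ball hz θ))).sub_const _).div_const _)).congr_deriv ?_
    have h1 : deriv q (z * Complex.exp (θ * Complex.I)) *
        (z * Complex.exp (θ * Complex.I) * Complex.I) / (z * deriv q z) =
        Complex.exp (I θ * Complex.I) * Complex.I := by
      have := hq.deriv_ne_zero z hz
      rw [div_eq_iff (mul_ne_zero h0 this)]
      linear_combination z * Complex.I * hI θ
    rw [h1]
    simp [Complex.exp_im]
  have hu0 : u 0 = 0 := by simp [u]
  have hu2 : u (2 * Real.pi) = 0 := by simp [u]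
  have hcont : Continuous u := continuous_iff_continuousAt.2 fun θ => (hu θ).continuousAt
  rcases le_or_gt (I θ).re Real.pi with hle | hgt
  · have : StrictAntiOn u (Icc 0 θ) := by
      refine strictAntiOn_of_deriv_neg (convex_Icc _ _) hcont.continuousOn fun t ht => ?_
      rw [interior_Icc] at ht
      rw [(hu t).deriv, neg_lt_zero]
      have h1 := hmono ht.1
      have h2 := hmono ht.2
      simp only [hI0, Complex.zero_re] at h1
      exact mul_pos (Real.exp_pos _) (Real.sin_pos_of_pos_of_lt_pi h1 (h2.trans_le hle))
    have := this ⟨le_rfl, hθ.1.le⟩ ⟨hθ.1.le, le_rfl⟩ hθ.1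
    rwa [hu0] at this
  · have : StrictMonoOn u (Icc θ (2 * Real.pi)) := by
      refine strictMonoOn_of_deriv_pos (convex_Icc _ _) hcont.continuousOn fun t ht => ?_
      rw [interior_Icc] at ht
      rw [(hu t).deriv, neg_pos]
      have h1 := hmono ht.1
      have h2 := hmono ht.2
      simp only [hI2] at h1 h2
      norm_num at h2
      refine mul_neg_of_pos_of_neg (Real.exp_pos _) ?_
      rw [← Real.sin_sub_two_pi]
      exact Real.sin_neg_of_neg_of_neg_pi_lt (by linarith) (by linarith)
    have := this ⟨le_rfl, hθ.2.le⟩ ⟨hθ.2.le, le_rfl⟩ hθ.2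
    rwa [hu2] at this

theorem re_neg_of_norm_eq (hq : IsConvexOnDisc q) {z₁ z₂ : ℂ} (hz₂ : z₂ ∈ ball (0 : ℂ) 1)
    (h : ‖z₁‖ = ‖z₂‖) (hne : z₁ ≠ z₂) : ((q z₁ - q z₂) / (z₂ * deriv q z₂)).re < 0 := by
  have h0 : z₂ ≠ 0 := by
    rintro rfl
    exact hne (norm_eq_zero.1 (h.trans norm_zero))
  have hquot : ‖z₁ / z₂‖ = 1 := by
    rw [norm_div, h, div_self (norm_ne_zero_iff.2 h0)]
  have harg : z₁ = z₂ * Complex.exp ((z₁ / z₂).arg * Complex.I) := by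
    have := Complex.norm_mul_exp_arg_mul_I (z₁ / z₂)
    rw [hquot, Complex.ofReal_one, one_mul] at this
    rw [this, mul_div_cancel₀ _ h0]
  have hpi := Real.pi_pos
  rcases lt_trichotomy (z₁ / z₂).arg 0 with hlt | heq | hgt
  · have := hq.re_neg_of_circle hz₂ h0 (θ := (z₁ / z₂).arg + 2 * Real.pi)
      ⟨by linarith [Complex.neg_pi_lt_arg (z₁ / z₂)], by linarith⟩
    push_cast at this
    rwa [add_mul, Complex.exp_add, Complex.exp_two_pi_mul_I, mul_one, ← harg] at this
  · simp only [heq, Complex.ofReal_zero, zero_mul, Complex.exp_zero, mul_one] at harg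
    exact absurd harg hne
  · have := hq.re_neg_of_circle hz₂ h0 (θ := (z₁ / z₂).arg)
      ⟨hgt, by linarith [Complex.arg_le_pi (z₁ / z₂)]⟩
    rwa [← harg] at this

theorem re_neg (hq : IsConvexOnDisc q) {z₁ z₂ : ℂ} (hz₂ : z₂ ∈ ball (0 : ℂ) 1)
    (h : ‖z₁‖ ≤ ‖z₂‖) (hne : z₁ ≠ z₂) : ((q z₁ - q z₂) / (z₂ * deriv q z₂)).re < 0 := by
  rcases h.eq_or_lt with heq | hlt
  · exact hq.re_neg_of_norm_eq hz₂ heq hne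
  by_contra! hnonneg
  have hpos : 0 < ‖z₂‖ := (norm_nonneg _).trans_lt hlt
  have hsub : closedBall (0 : ℂ) ‖z₂‖ ⊆ ball 0 1 :=
    closedBall_subset_ball (mem_ball_zero_iff.1 hz₂)
  let E : ℂ → ℂ := fun x => Complex.exp ((q x - q z₂) / (z₂ * deriv q z₂))
  have hE : DiffContOnCl ℂ E (ball 0 ‖z₂‖) :=
    DifferentiableOn.diffContOnCl_ball (U := ball 0 1)
      (((hq.differentiableOn.sub_const _).div_const _).cexp) hsub
  have hEn : ∀ x, ‖E x‖ = Real.exp ((q x - q z₂) / (z₂ * deriv q z₂)).re := fun x =>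
    Complex.norm_exp _
  have hbound : ∀ x ∈ ball (0 : ℂ) ‖z₂‖, ‖E x‖ ≤ 1 := by
    intro x hx
    refine Complex.norm_le_of_forall_mem_frontier_norm_le isBounded_ball hE ?_ (subset_closure hx)
    intro y hy
    rw [frontier_ball _ hpos.ne', mem_sphere_zero_iff_norm] at hy
    rw [hEn, Real.exp_le_one_iff]
    rcases eq_or_ne y z₂ with rfl | hy2
    · simp
    · exact (hq.re_neg_of_norm_eq hz₂ hy hy2).le
  have hz₁ : z₁ ∈ ball (0 : ℂ) ‖z₂‖ := by simpa using hlt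
  have hone : 1 ≤ ‖E z₁‖ := by rw [hEn]; exact Real.one_le_exp hnonneg
  have hmem : -z₂ ∈ closure (ball (0 : ℂ) ‖z₂‖) := by
    rw [closure_ball _ hpos.ne']; simp
  have := Complex.norm_eqOn_closure_of_isPreconnected_of_isMaxOn
    (convex_ball (0 : ℂ) ‖z₂‖).isPreconnected isOpen_ball hE hz₁
    (fun x hx => (hbound x hx).trans hone) hmem
  have hlt1 : ‖E (-z₂)‖ < 1 := by
    rw [hEn, Real.exp_lt_one_iff]
    exact hq.re_neg_of_norm_eq hz₂ (norm_neg _) (by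
      rw [Ne, neg_eq_self]
      exact norm_pos_iff.1 hpos)
  simp only [Function.comp_apply, Function.const_apply] at this
  linarith

theorem injOn (hq : IsConvexOnDisc q) : InjOn q (ball 0 1) := by
  have key : ∀ z₁ z₂ : ℂ, z₂ ∈ ball (0 : ℂ) 1 → ‖z₁‖ ≤ ‖z₂‖ → q z₁ = q z₂ → z₁ = z₂ := by
    intro z₁ z₂ hz₂ hle heq
    by_contra hne
    have := hq.re_neg hz₂ hle hne
    simp [heq] at this
  intro z₁ hz₁ z₂ hz₂ heq
  rcases le_total ‖z₁‖ ‖z₂‖ with h | h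
  · exact key z₁ z₂ hz₂ h heq
  · exact (key z₂ z₁ hz₁ h heq.symm).symm

end IsConvexOnDisc

theorem exists_norm_minimal_notMem {V : Set ℂ} (hV : IsOpen V) {z : ℂ} (hz : z ∉ V) :
    ∃ z₀ ∉ V, ‖z₀‖ ≤ ‖z‖ ∧ ∀ x, ‖x‖ < ‖z₀‖ → x ∈ V := by
  obtain ⟨z₀, hz₀, hd⟩ := hV.isClosed_compl.exists_infDist_eq_dist ⟨z, hz⟩ 0
  have hle : ∀ x ∉ V, ‖z₀‖ ≤ ‖x‖ := fun x hx => by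
    have := infDist_le_dist_of_mem (x := (0 : ℂ)) (show x ∈ Vᶜ from hx)
    rwa [hd, dist_zero_left, dist_zero_left] at this
  exact ⟨z₀, hz₀, hle z hz, fun x hx => by_contra fun h => (hle x h).not_gt hx⟩

theorem mem_of_forall_norm_lt {X : Type*} [TopologicalSpace X] {g : ℂ → X} {C : Set X}
    (hC : IsClosed C) {z₀ : ℂ} (h0 : z₀ ≠ 0) (hg : ContinuousAt g z₀)
    (h : ∀ z, ‖z‖ < ‖z₀‖ → g z ∈ C) : g z₀ ∈ C := by
  have hmem : z₀ ∈ closure (ball (0 : ℂ) ‖z₀‖) := by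
    rw [closure_ball _ (norm_ne_zero_iff.2 h0)]; simp
  have := mem_closure_iff_nhdsWithin_neBot.1 hmem
  refine hC.mem_of_tendsto (hg.tendsto.mono_left (nhdsWithin_le_nhds (s := ball 0 ‖z₀‖))) ?_
  filter_upwards [self_mem_nhdsWithin] with z hz using h z (by simpa using hz)

/-- A form of Jack's lemma. -/
theorem exists_mul_deriv_eq_neg_of_re_minimal {g : ℂ → ℂ} {z₀ g' : ℂ} (h0 : z₀ ≠ 0)
    (hg : HasDerivAt g g' z₀) (hmin : ∀ z, ‖z‖ < ‖z₀‖ → (g z₀).re ≤ (g z).re) :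
    ∃ k : ℝ, 0 ≤ k ∧ z₀ * g' = -k := by
  have key : ∀ M : ℝ, (z₀ * g').re + M * (z₀ * g').im ≤ 0 := by
    intro M
    have hline : HasDerivAt (fun t : ℝ => z₀ + t * (z₀ * (-1 + M * Complex.I)))
        (z₀ * (-1 + M * Complex.I)) 0 := by
      simpa using ((Complex.ofRealCLM.hasDerivAt (x := (0 : ℝ))).mul_const
        (z₀ * (-1 + M * Complex.I))).const_add z₀
    have hz : z₀ = z₀ + ((0 : ℝ) : ℂ) * (z₀ * (-1 + M * Complex.I)) := by simp
    have hg0 := hg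
    rw [hz] at hg0
    have hc := (hg0.comp (0 : ℝ) hline).neg
    have := re_nonpos_of_hasDerivAt hc ?_
    · have e : -(g' * (z₀ * (-1 + M * Complex.I))) = z₀ * g' - M * (z₀ * g') * Complex.I := by ring
      rw [e] at this
      simpa using this
    · have hM : 0 < 2 / (1 + M ^ 2) := by positivity
      filter_upwards [Ioo_mem_nhdsGT hM] with t ht
      simp only [Pi.neg_apply, Function.comp_apply, Complex.neg_re, neg_le_neg_iff, ← hz]
      refine hmin _ ?_
      rw [show z₀ + t * (z₀ * (-1 + M * Complex.I)) =
        z₀ * ((1 - t : ℝ) + (t * M : ℝ) * Complex.I) by push_cast; ring, norm_mul]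
      refine mul_lt_of_lt_one_right (norm_pos_iff.2 h0) ?_
      rw [Complex.norm_add_mul_I, Real.sqrt_lt' one_pos]
      have h2 := (lt_div_iff₀ (by positivity)).1 ht.2
      nlinarith [ht.1]
  have hre := key 0
  have him : (z₀ * g').im = 0 := by
    by_contra hne
    have := key ((1 - (z₀ * g').re) / (z₀ * g').im)
    rw [div_mul_cancel₀ _ hne] at this
    linarith
  refine ⟨-(z₀ * g').re, by linarith, ?_⟩
  apply Complex.ext <;> simp [him]

theorem re_div_one_add_mul_nonneg {α P : ℂ} (hα : 0 ≤ α.re) (hP : 0 ≤ P.re) :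
    0 ≤ (α / (1 + α * P)).re := by
  rw [Complex.div_re, ← add_div]
  refine div_nonneg ?_ (Complex.normSq_nonneg _)
  simp only [Complex.add_re, Complex.add_im, Complex.mul_re, Complex.mul_im, Complex.one_re,
    Complex.one_im]
  nlinarith [mul_nonneg (sq_nonneg α.re) hP, mul_nonneg (sq_nonneg α.im) hP]

section EulerEquation

variable {α : ℂ} {h q : ℂ → ℂ}

theorem deriv_eq_of_euler (hq : DifferentiableOn ℂ q (ball 0 1))
    (hode : ∀ z ∈ ball (0 : ℂ) 1, q z + α * z * deriv q z = h z) {z : ℂ}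
    (hz : z ∈ ball (0 : ℂ) 1) :
    deriv h z = deriv q z + α * (deriv q z + z * deriv (deriv q) z) := by
  have h1 : HasDerivAt (fun z => q z + α * z * deriv q z)
      (deriv q z + (α * 1 * deriv q z + α * z * deriv (deriv q) z)) z :=
    (hasDerivAt_of_differentiableOn_ball hq hz).add
      (((hasDerivAt_id z).const_mul α).mul (hasDerivAt_deriv_of_differentiableOn_ball hq hz))
  have h2 : h =ᶠ[𝓝 z] fun z => q z + α * z * deriv q z := by
    filter_upwards [isOpen_ball.mem_nhds hz] with x hx using (hode x hx).symm
  rw [(h1.congr_of_eventuallyEq h2).deriv]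
  ring

theorem IsConvexOnDisc.of_euler (hα : 0 ≤ α.re) (hh : IsConvexOnDisc h)
    (hq : DifferentiableOn ℂ q (ball 0 1))
    (hode : ∀ z ∈ ball (0 : ℂ) 1, q z + α * z * deriv q z = h z) : IsConvexOnDisc q := by
  have hq1 := hq.deriv isOpen_ball
  have hq2 := hq1.deriv isOpen_ball
  set s : ℂ → ℂ := fun z => deriv q z + z * deriv (deriv q) z with hs
  have hsd : DifferentiableOn ℂ s (ball 0 1) := hq1.add (differentiableOn_id.mul hq2)
  have hdh : ∀ z ∈ ball (0 : ℂ) 1, deriv h z = deriv q z + α * s z :=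
    fun z hz => deriv_eq_of_euler hq hode hz
  let V : Set ℂ := ball 0 1 ∩ {z | 0 < (s z * star (deriv q z)).re}
  have hV : IsOpen V :=
    (Complex.continuous_re.comp_continuousOn (hsd.continuousOn.mul
      hq1.continuousOn.star)).isOpen_inter_preimage isOpen_ball isOpen_Ioi
  have hVq : ∀ z ∈ V, deriv q z ≠ 0 := fun z hz h0 => by
    have := hz.2
    simp [h0] at this
  have hdiv_re : ∀ a b : ℂ, (a / b).re = (a * star b).re / Complex.normSq b := fun a b => by
    rw [Complex.div_re, ← add_div]
    simp
  have hVre : ∀ z ∈ V, 0 < (s z / deriv q z).re := fun z hz => by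
    rw [hdiv_re]
    exact div_pos hz.2 (Complex.normSq_pos.2 (hVq z hz))
  have hcurv : ∀ z, deriv q z ≠ 0 → s z / deriv q z = 1 + z * deriv (deriv q) z / deriv q z :=
    fun z hz => by rw [hs, add_div, div_self hz]
  suffices hsub : ∀ z ∈ ball (0 : ℂ) 1, z ∈ V from
    ⟨hq, fun z hz => hVq z (hsub z hz), fun z hz => by
      rw [← hcurv z (hVq z (hsub z hz))]
      exact hVre z (hsub z hz)⟩
  by_contra! hbad
  obtain ⟨z₁, hz₁, hz₁V⟩ := hbad
  obtain ⟨z, hzV, hle, hgood⟩ := exists_norm_minimal_notMem hV hz₁V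
  have hz : z ∈ ball (0 : ℂ) 1 := by
    rw [mem_ball_zero_iff] at hz₁ ⊢
    exact hle.trans_lt hz₁
  have hhz := hh.deriv_ne_zero z hz
  have hq1z := hasDerivAt_of_differentiableOn_ball hq1 hz
  have hsz := hasDerivAt_of_differentiableOn_ball hsd hz
  have hz0 : z ≠ 0 := by
    rintro rfl
    refine hzV ⟨hz, ?_⟩
    have hne : deriv q 0 ≠ 0 := fun h0 => by
      rw [hdh 0 hz] at hhz
      simp [hs, h0] at hhz
    have := Complex.normSq_pos.2 hne
    simpa [hs, Complex.normSq_apply] using this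
  by_cases hqz : deriv q z = 0
  · have hs0 : s z ≠ 0 := fun h0 => by
      rw [hdh z hz] at hhz
      simp [hqz, h0] at hhz
    obtain ⟨k, hk, hkeq⟩ := exists_mul_deriv_eq_neg_of_re_minimal hz0 (hq1z.div hsz hs0)
      fun x hx => by
        simp only [Pi.div_apply, hqz, zero_div, Complex.zero_re]
        rw [← inv_div, Complex.inv_re]
        exact div_nonneg (hVre x (hgood x hx)).le (Complex.normSq_nonneg _)
    have hsz' : s z = z * deriv (deriv q) z := by simp [hs, hqz]
    have h1 : z * ((deriv (deriv q) z * s z - deriv q z * deriv s z) / s z ^ 2) = 1 := by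
      rw [hqz, zero_mul, sub_zero]
      field_simp
      rw [hsz']
    rw [h1] at hkeq
    have := congrArg Complex.re hkeq
    simp at this
    linarith
  · have hPd := hsz.div hq1z hqz
    have hPnonneg : 0 ≤ (s z / deriv q z).re :=
      mem_of_forall_norm_lt (g := fun x => (s x / deriv q x).re) isClosed_Ici hz0
        (Complex.continuous_re.continuousAt.comp hPd.continuousAt)
        fun x hx => (hVre x (hgood x hx)).le
    have hP0 : (s z / deriv q z).re = 0 := by
      refine le_antisymm ?_ hPnonneg
      rw [hdiv_re]
      exact div_nonpos_of_nonpos_of_nonneg (not_lt.1 fun hlt => hzV ⟨hz, hlt⟩)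
        (Complex.normSq_nonneg _)
    obtain ⟨k, hk, hkeq⟩ := exists_mul_deriv_eq_neg_of_re_minimal hz0 hPd fun x hx => by
      simp only [Pi.div_apply, hP0]
      exact (hVre x (hgood x hx)).le
    have hddh : deriv (deriv h) z = deriv (deriv q) z + α * deriv s z := by
      have h2 : deriv h =ᶠ[𝓝 z] fun z => deriv q z + α * s z := by
        filter_upwards [isOpen_ball.mem_nhds hz] with x hx using hdh x hx
      exact ((hq1z.add (hsz.const_mul α)).congr_of_eventuallyEq h2).deriv
    have hpos := hh.re_pos z hz
    have hfac : deriv h z = deriv q z * (1 + α * (s z / deriv q z)) := by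
      rw [hdh z hz]; field_simp
    have hne : 1 + α * (s z / deriv q z) ≠ 0 := fun h0 => hhz (by rw [hfac, h0, mul_zero])
    have hform : 1 + z * deriv (deriv h) z / deriv h z =
        s z / deriv q z - k * (α / (1 + α * (s z / deriv q z))) := by
      rw [sub_eq_add_neg, ← neg_mul, ← hkeq, hddh, hfac]
      have hsz' : s z = deriv q z + z * deriv (deriv q) z := rfl
      have hden : deriv q z + α * s z ≠ 0 := by rwa [← hdh z hz]
      field_simp
      linear_combination -(deriv q z + α * s z) * hsz'
    rw [hform, Complex.sub_re, hP0, Complex.re_ofReal_mul] at hpos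
    have := mul_nonneg hk (re_div_one_add_mul_nonneg hα hPnonneg)
    linarith

theorem exists_subordination_of_euler (hα : 0 ≤ α.re) (hh : IsConvexOnDisc h)
    (hq : DifferentiableOn ℂ q (ball 0 1))
    (hode : ∀ z ∈ ball (0 : ℂ) 1, q z + α * z * deriv q z = h z)
    {p w : ℂ → ℂ} (hp : DifferentiableOn ℂ p (ball 0 1)) (hw : DifferentiableOn ℂ w (ball 0 1))
    (hw0 : w 0 = 0) (hw1 : ∀ z ∈ ball (0 : ℂ) 1, ‖w z‖ < 1)
    (hpode : ∀ z ∈ ball (0 : ℂ) 1, p z + α * z * deriv p z = h (w z)) :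
    ∃ ω : ℂ → ℂ, DifferentiableOn ℂ ω (ball 0 1) ∧ ω 0 = 0 ∧
      (∀ z ∈ ball (0 : ℂ) 1, ‖ω z‖ < 1) ∧ ∀ z ∈ ball (0 : ℂ) 1, p z = q (ω z) := by
  have hqc : IsConvexOnDisc q := hh.of_euler hα hq hode
  obtain ⟨hopen, ψ, hψ⟩ := exists_leftInverse_hasDerivAt_of_injOn isOpen_ball
    (convex_ball (0 : ℂ) 1).isPreconnected hq hqc.injOn
  have h0mem : (0 : ℂ) ∈ ball (0 : ℂ) 1 := mem_ball_self one_pos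
  have hpq0 : p 0 = q 0 := by
    have h1 := hpode 0 h0mem
    have h2 := hode 0 h0mem
    simp only [mul_zero, zero_mul, add_zero, hw0] at h1 h2
    rw [h1, h2]
  have hψp : ∀ z ∈ ball (0 : ℂ) 1, ∀ ζ ∈ ball (0 : ℂ) 1, q ζ = p z →
      HasDerivAt (ψ ∘ p) ((deriv q ζ)⁻¹ * deriv p z) z := by
    intro z hz ζ hζ heq
    have := (hψ ζ hζ).2.2
    rw [heq] at this
    exact this.comp z (hasDerivAt_of_differentiableOn_ball hp hz)
  have hψp0 : (ψ ∘ p) 0 = 0 := by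
    rw [Function.comp_apply, hpq0, (hψ 0 h0mem).1]
  have key : ∀ R : ℝ, 0 < R → R < 1 → ∀ z, ‖z‖ < R → p z ∈ q '' ball 0 R := by
    intro R hR0 hR1
    have hsub : ball (0 : ℂ) R ⊆ ball 0 1 := ball_subset_ball hR1.le
    by_contra! hbad
    obtain ⟨z₁, hz₁R, hz₁⟩ := hbad
    have hV : IsOpen (ball (0 : ℂ) 1 ∩ p ⁻¹' (q '' ball 0 R)) :=
      hp.continuousOn.isOpen_inter_preimage isOpen_ball (hopen _ hsub isOpen_ball)
    obtain ⟨z, hzV, hle, hgood⟩ := exists_norm_minimal_notMem hV fun h => hz₁ h.2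
    have hzR : ‖z‖ < R := hle.trans_lt hz₁R
    have hz : z ∈ ball (0 : ℂ) 1 := hsub (mem_ball_zero_iff.2 hzR)
    have hpz : p z ∉ q '' ball 0 R := fun hmem => hzV ⟨hz, hmem⟩
    have hz0 : z ≠ 0 := by
      rintro rfl
      exact hpz ⟨0, mem_ball_self hR0, hpq0.symm⟩
    have hclosed : IsClosed (q '' closedBall 0 R) :=
      ((isCompact_closedBall 0 R).image_of_continuousOn
        (hq.continuousOn.mono (closedBall_subset_ball hR1))).isClosed
    obtain ⟨ζ, hζ, hζp⟩ : p z ∈ q '' closedBall 0 R :=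
      mem_of_forall_norm_lt hclosed hz0
        (hasDerivAt_of_differentiableOn_ball hp hz).continuousAt
        fun x hx => image_mono ball_subset_closedBall (hgood x hx).2
    have hζR : ‖ζ‖ = R := by
      refine le_antisymm (mem_closedBall_zero_iff.1 hζ) (not_lt.1 fun hlt => ?_)
      exact hpz ⟨ζ, mem_ball_zero_iff.2 hlt, hζp⟩
    have hζ0 : ζ ≠ 0 := norm_pos_iff.1 (hζR ▸ hR0)
    have hζ1 : ζ ∈ ball (0 : ℂ) 1 := mem_ball_zero_iff.2 (hζR ▸ hR1)
    have hωz : (ψ ∘ p) z = ζ := by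
      rw [Function.comp_apply, ← hζp, (hψ ζ hζ1).1]
    have hschwarz : ∀ x, ‖x‖ < ‖z‖ → ‖(ψ ∘ p) x‖ ≤ R / ‖z‖ * ‖x‖ := by
      intro x hx
      have := Complex.dist_le_div_mul_dist_of_mapsTo_ball (f := ψ ∘ p) (c := 0) (R₁ := ‖z‖)
        (R₂ := R) (z := x) ?_ ?_ (by simpa using hx)
      · simpa only [hψp0, dist_zero_right] using this
      · intro y hy
        obtain ⟨hy1, ξ, hξ, hξy⟩ := hgood y (by simpa using hy)
        exact (hψp y hy1 ξ (hsub hξ) hξy).differentiableAt.differentiableWithinAt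
      · intro y hy
        obtain ⟨hy1, ξ, hξ, hξy⟩ := hgood y (by simpa using hy)
        rw [hψp0, Function.comp_apply, ← hξy, (hψ ξ (hsub hξ)).1]
        exact ball_subset_closedBall hξ
    have hg : HasDerivAt (fun x => -((ψ ∘ p) x * z / (x * ζ)))
        (-((deriv q ζ)⁻¹ * deriv p z / ζ - 1 / z)) z := by
      refine ((((hψp z hz ζ hζ1 hζp).mul_const z).div ((hasDerivAt_id z).mul_const ζ)
        (mul_ne_zero hz0 hζ0)).neg).congr_deriv ?_
      rw [hωz]
      simp only [id_eq]
      generalize (deriv q ζ)⁻¹ * deriv p z = d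
      field_simp
    obtain ⟨k, hk, hkeq⟩ := exists_mul_deriv_eq_neg_of_re_minimal hz0 hg fun x hx => by
      have h1 : (-((ψ ∘ p) z * z / (z * ζ))).re = -1 := by
        rw [hωz, mul_comm ζ z, div_self (mul_ne_zero hz0 hζ0)]; simp
      rw [h1, Complex.neg_re, neg_le_neg_iff]
      refine (Complex.re_le_norm _).trans ?_
      rw [norm_div, norm_mul, norm_mul, hζR]
      refine div_le_one_of_le₀ ?_ (by positivity)
      calc ‖(ψ ∘ p) x‖ * ‖z‖ ≤ R / ‖z‖ * ‖x‖ * ‖z‖ := by gcongr; exact hschwarz x hx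
        _ = ‖x‖ * R := by
          have := norm_ne_zero_iff.2 hz0
          field_simp
    have hqζ := hqc.deriv_ne_zero ζ hζ1
    have hhζ := hh.deriv_ne_zero ζ hζ1
    have hzp : z * deriv p z = (1 + k) * (ζ * deriv q ζ) := by
      field_simp at hkeq
      linear_combination -hkeq
    have hdiff : h (w z) - h ζ = k * (α * (ζ * deriv q ζ)) := by
      rw [← hpode z hz, ← hode ζ hζ1, hζp]
      linear_combination α * hzp
    have hwz : ‖w z‖ < ‖ζ‖ := by
      rw [hζR]
      refine lt_of_le_of_lt ?_ hzR
      exact Complex.norm_le_norm_of_mapsTo_ball hw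
        (fun x hx => mem_closedBall_zero_iff.2 (hw1 x hx).le) hw0 (mem_ball_zero_iff.1 hz)
    have hneg := hh.re_neg hζ1 hwz.le fun he => hwz.ne (congrArg norm he)
    have hP := hqc.re_pos ζ hζ1
    have hpos := mul_nonneg hk (re_div_one_add_mul_nonneg hα hP.le)
    rw [← Complex.re_ofReal_mul] at hpos
    have hdh := deriv_eq_of_euler hq hode hζ1
    have hfac : deriv h ζ =
        deriv q ζ * (1 + α * (1 + ζ * deriv (deriv q) ζ / deriv q ζ)) := by
      rw [hdh]; field_simp
    have hne : 1 + α * (1 + ζ * deriv (deriv q) ζ / deriv q ζ) ≠ 0 := fun h0 =>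
      hhζ (by rw [hfac, h0, mul_zero])
    have heq : (h (w z) - h ζ) / (ζ * deriv h ζ) =
        k * (α / (1 + α * (1 + ζ * deriv (deriv q) ζ / deriv q ζ))) := by
      rw [hdiff, hfac]
      generalize 1 + α * (1 + ζ * deriv (deriv q) ζ / deriv q ζ) = d at hne ⊢
      field_simp
    rw [heq] at hneg
    linarith
  have hmem : ∀ z ∈ ball (0 : ℂ) 1, ∃ ζ ∈ ball (0 : ℂ) 1, q ζ = p z := by
    intro z hz
    rw [mem_ball_zero_iff] at hz
    obtain ⟨ζ, hζ, he⟩ := key ((‖z‖ + 1) / 2) (by positivity) (by linarith) z (by linarith)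
    exact ⟨ζ, ball_subset_ball (by linarith) hζ, he⟩
  refine ⟨ψ ∘ p, fun z hz => ?_, hψp0, fun z hz => ?_, fun z hz => ?_⟩ <;>
    obtain ⟨ζ, hζ, he⟩ := hmem z hz
  · exact (hψp z hz ζ hζ he).differentiableAt.differentiableWithinAt
  · rw [Function.comp_apply, ← he, (hψ ζ hζ).1]
    exact mem_ball_zero_iff.1 hζ
  · rw [Function.comp_apply, ← he, (hψ ζ hζ).1]

end EulerEquation

section PowerKernel

variable {α : ℂ} {h : ℂ → ℂ}

theorem norm_ofReal_cpow_le_one (hα : 0 ≤ α.re) {t : ℝ} (ht : t ∈ Ioc (0 : ℝ) 1) :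
    ‖(t : ℂ) ^ α‖ ≤ 1 := by
  rw [Complex.norm_cpow_eq_rpow_re_of_pos ht.1]
  exact Real.rpow_le_one ht.1.le ht.2 hα

theorem norm_mul_ofReal_cpow_le (hα : 0 ≤ α.re) (z : ℂ) {t : ℝ} (ht : t ∈ Ioc (0 : ℝ) 1) :
    ‖z * (t : ℂ) ^ α‖ ≤ ‖z‖ := by
  rw [norm_mul]
  exact mul_le_of_le_one_right (norm_nonneg _) (norm_ofReal_cpow_le_one hα ht)

theorem continuousOn_ofReal_cpow : ContinuousOn (fun t : ℝ => (t : ℂ) ^ α) (Ioc (0 : ℝ) 1) :=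
  Complex.continuous_ofReal.continuousOn.cpow continuousOn_const fun _ ht => Or.inl ht.1

theorem continuousOn_comp_mul_cpow (hα : 0 ≤ α.re) (hh : ContinuousOn h (ball 0 1)) {z : ℂ}
    (hz : z ∈ ball (0 : ℂ) 1) :
    ContinuousOn (fun t : ℝ => h (z * (t : ℂ) ^ α)) (Ioc (0 : ℝ) 1) := by
  refine hh.comp (continuousOn_const.mul continuousOn_ofReal_cpow) fun t ht => ?_
  rw [mem_ball_zero_iff] at hz ⊢
  exact (norm_mul_ofReal_cpow_le hα z ht).trans_lt hz

theorem exists_norm_le_of_continuousOn_ball (hh : ContinuousOn h (ball 0 1)) {r : ℝ} (hr : r < 1) :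
    ∃ C, ∀ x : ℂ, ‖x‖ ≤ r → ‖h x‖ ≤ C := by
  obtain ⟨C, hC⟩ := (isCompact_closedBall (0 : ℂ) r).exists_bound_of_continuousOn
    (hh.mono (closedBall_subset_ball hr))
  exact ⟨C, fun x hx => hC x (mem_closedBall_zero_iff.2 hx)⟩

theorem intervalIntegrable_comp_mul_cpow (hα : 0 ≤ α.re) (hh : ContinuousOn h (ball 0 1)) {z : ℂ}
    (hz : z ∈ ball (0 : ℂ) 1) :
    IntervalIntegrable (fun t : ℝ => h (z * (t : ℂ) ^ α)) MeasureTheory.volume 0 1 := by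
  obtain ⟨C, hC⟩ := exists_norm_le_of_continuousOn_ball hh (mem_ball_zero_iff.1 hz)
  rw [intervalIntegrable_iff_integrableOn_Ioc_of_le zero_le_one]
  refine MeasureTheory.IntegrableOn.of_bound (by simp)
    ((continuousOn_comp_mul_cpow hα hh hz).aestronglyMeasurable measurableSet_Ioc) C ?_
  filter_upwards [MeasureTheory.ae_restrict_mem measurableSet_Ioc] with t ht
  exact hC _ (norm_mul_ofReal_cpow_le hα z ht)

theorem hasDerivAt_integral_comp_mul_cpow (hα : 0 ≤ α.re) (hh : DifferentiableOn ℂ h (ball 0 1))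
    {z : ℂ} (hz : z ∈ ball (0 : ℂ) 1) :
    IntervalIntegrable (fun t : ℝ => deriv h (z * (t : ℂ) ^ α) * (t : ℂ) ^ α)
      MeasureTheory.volume 0 1 ∧
    HasDerivAt (fun z => ∫ t in (0 : ℝ)..1, h (z * (t : ℂ) ^ α))
      (∫ t in (0 : ℝ)..1, deriv h (z * (t : ℂ) ^ α) * (t : ℂ) ^ α) z := by
  have hh1 := hh.deriv isOpen_ball
  rw [mem_ball_zero_iff] at hz
  obtain ⟨C, hC⟩ := exists_norm_le_of_continuousOn_ball hh1.continuousOn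
    (show (‖z‖ + 1) / 2 < 1 by linarith)
  have hs : ball (0 : ℂ) ((‖z‖ + 1) / 2) ∈ 𝓝 z :=
    isOpen_ball.mem_nhds (by rw [mem_ball_zero_iff]; linarith)
  have hz' := mem_ball_zero_iff.2 hz
  refine intervalIntegral.hasDerivAt_integral_of_dominated_loc_of_deriv_le
    (F := fun z (t : ℝ) => h (z * (t : ℂ) ^ α))
    (F' := fun z (t : ℝ) => deriv h (z * (t : ℂ) ^ α) * (t : ℂ) ^ α)
    (bound := fun _ => C) hs ?_ (intervalIntegrable_comp_mul_cpow hα hh.continuousOn hz') ?_ ?_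
    intervalIntegrable_const ?_
  · filter_upwards [isOpen_ball.mem_nhds hz'] with x hx
    rw [uIoc_of_le zero_le_one]
    exact (continuousOn_comp_mul_cpow hα hh.continuousOn hx).aestronglyMeasurable
      measurableSet_Ioc
  · rw [uIoc_of_le zero_le_one]
    exact ((continuousOn_comp_mul_cpow hα hh1.continuousOn hz').mul
      continuousOn_ofReal_cpow).aestronglyMeasurable measurableSet_Ioc
  · refine Eventually.of_forall fun t ht x hx => ?_
    rw [uIoc_of_le zero_le_one] at ht
    rw [norm_mul]
    rw [mem_ball_zero_iff] at hx
    exact (mul_le_of_le_one_right (norm_nonneg _) (norm_ofReal_cpow_le_one hα ht)).trans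
      (hC _ ((norm_mul_ofReal_cpow_le hα x ht).trans hx.le))
  · refine Eventually.of_forall fun t ht x hx => ?_
    rw [uIoc_of_le zero_le_one] at ht
    rw [mem_ball_zero_iff] at hx
    have hmem : x * (t : ℂ) ^ α ∈ ball (0 : ℂ) 1 :=
      mem_ball_zero_iff.2 ((norm_mul_ofReal_cpow_le hα x ht).trans_lt (by linarith))
    have h1 : HasDerivAt (fun x : ℂ => x * (t : ℂ) ^ α) ((t : ℂ) ^ α) x := by
      simpa using (hasDerivAt_id x).mul_const ((t : ℂ) ^ α)
    exact (hasDerivAt_of_differentiableOn_ball hh hmem).comp x h1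

theorem differentiableOn_integral_comp_mul_cpow (hα : 0 ≤ α.re)
    (hh : DifferentiableOn ℂ h (ball 0 1)) :
    DifferentiableOn ℂ (fun z => ∫ t in (0 : ℝ)..1, h (z * (t : ℂ) ^ α)) (ball 0 1) :=
  fun _ hz => (hasDerivAt_integral_comp_mul_cpow hα hh hz).2.differentiableAt.differentiableWithinAt

theorem euler_integral_comp_mul_cpow (hα : 0 ≤ α.re) (hh : DifferentiableOn ℂ h (ball 0 1))
    {z : ℂ} (hz : z ∈ ball (0 : ℂ) 1) :
    (∫ t in (0 : ℝ)..1, h (z * (t : ℂ) ^ α)) +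
      α * z * deriv (fun z => ∫ t in (0 : ℝ)..1, h (z * (t : ℂ) ^ α)) z = h z := by
  obtain ⟨hint, hderiv⟩ := hasDerivAt_integral_comp_mul_cpow hα hh hz
  have hint0 := intervalIntegrable_comp_mul_cpow hα hh.continuousOn hz
  rw [hderiv.deriv, ← intervalIntegral.integral_const_mul,
    ← intervalIntegral.integral_add hint0 (hint.const_mul _)]
  have hmem : ∀ t ∈ Ioc (0 : ℝ) 1, z * (t : ℂ) ^ α ∈ ball (0 : ℂ) 1 := fun t ht => by
    rw [mem_ball_zero_iff] at hz ⊢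
    exact (norm_mul_ofReal_cpow_le hα z ht).trans_lt hz
  rw [intervalIntegral.integral_eq_sub_of_hasDerivAt_of_le
    (f := fun t : ℝ => (t : ℂ) * h (z * (t : ℂ) ^ α)) zero_le_one ?_ ?_
    (hint0.add (hint.const_mul _))]
  · simp
  · intro t ht
    rcases ht.1.eq_or_lt with rfl | hpos
    · obtain ⟨C, hC⟩ := exists_norm_le_of_continuousOn_ball hh.continuousOn
        (mem_ball_zero_iff.1 hz)
      have hlim : Tendsto (fun t : ℝ => t * C) (𝓝[Icc 0 1] 0) (𝓝 0) := by
        have : Continuous fun t : ℝ => t * C := by fun_prop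
        simpa using this.continuousWithinAt.tendsto (s := Icc (0 : ℝ) 1) (x := 0)
      rw [ContinuousWithinAt]
      simp only [Complex.ofReal_zero, zero_mul]
      refine squeeze_zero_norm' ?_ hlim
      filter_upwards [self_mem_nhdsWithin] with t ht
      rcases ht.1.eq_or_lt with rfl | hpos
      · simp
      rw [norm_mul, Complex.norm_of_nonneg ht.1]
      exact mul_le_mul_of_nonneg_left (hC _ (norm_mul_ofReal_cpow_le hα z ⟨hpos, ht.2⟩)) ht.1
    · have hc : ContinuousWithinAt (fun t : ℝ => h (z * (t : ℂ) ^ α)) (Icc 0 1) t := by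
        refine (continuousOn_comp_mul_cpow hα hh.continuousOn hz t
          ⟨hpos, ht.2⟩).mono_of_mem_nhdsWithin ?_
        filter_upwards [self_mem_nhdsWithin, nhdsWithin_le_nhds (Ioi_mem_nhds hpos)] with x hx hx0
        exact ⟨hx0, hx.2⟩
      exact Complex.continuous_ofReal.continuousWithinAt.mul hc
  · intro t ht
    have h1 : HasDerivAt (fun t : ℝ => z * (t : ℂ) ^ α) (z * (α * (t : ℂ) ^ (α - 1))) t := by
      have := ((hasDerivAt_id (t : ℂ)).cpow_const (c := α)
        (Complex.ofReal_mem_slitPlane.2 ht.1)).comp_ofReal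
      simpa using this.const_mul z
    have h2 := (hasDerivAt_of_differentiableOn_ball hh (hmem t ⟨ht.1, ht.2.le⟩)).comp t h1
    refine ((Complex.ofRealCLM.hasDerivAt (x := t)).mul h2).congr_deriv ?_
    have ht0 : (t : ℂ) ≠ 0 := Complex.ofReal_ne_zero.2 ht.1.ne'
    have h3 : (t : ℂ) * (t : ℂ) ^ (α - 1) = (t : ℂ) ^ α := by
      rw [Complex.cpow_sub _ _ ht0, Complex.cpow_one, mul_div_cancel₀ _ ht0]
    simp only [Complex.ofRealCLM_apply, Complex.ofReal_one, one_mul, Function.comp_apply]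
    linear_combination z * α * deriv h (z * (t : ℂ) ^ α) * h3

theorem integral_comp_mul_cpow_eq_tsum (hα : 0 ≤ α.re) (hh : ContinuousOn h (ball 0 1))
    {c : ℕ → ℂ} (hc : ∀ z ∈ ball (0 : ℂ) 1, Summable fun n => c n * z ^ (n + 1))
    (hsum : ∀ z ∈ ball (0 : ℂ) 1, h z = 1 + ∑' n, c n * z ^ (n + 1)) {z : ℂ}
    (hz : z ∈ ball (0 : ℂ) 1) :
    ∫ t in (0 : ℝ)..1, h (z * (t : ℂ) ^ α) =
      1 + ∑' n : ℕ, c n / (1 + ((n : ℂ) + 1) * α) * z ^ (n + 1) := by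
  have hmem : ∀ t ∈ Ioc (0 : ℝ) 1, z * (t : ℂ) ^ α ∈ ball (0 : ℂ) 1 := fun t ht => by
    rw [mem_ball_zero_iff] at hz ⊢
    exact (norm_mul_ofReal_cpow_le hα z ht).trans_lt hz
  have hS := intervalIntegral.hasSum_integral_of_dominated_convergence
    (μ := MeasureTheory.volume) (a := 0) (b := 1)
    (F := fun n (t : ℝ) => c n * (z * (t : ℂ) ^ α) ^ (n + 1))
    (f := fun t : ℝ => h (z * (t : ℂ) ^ α) - 1) (fun n _ => ‖c n * z ^ (n + 1)‖) ?_ ?_ ?_ ?_ ?_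
  · rw [intervalIntegral.integral_sub (intervalIntegrable_comp_mul_cpow hα hh hz)
      intervalIntegrable_const, intervalIntegral.integral_const, sub_zero, one_smul] at hS
    rw [← sub_eq_iff_eq_add', ← hS.tsum_eq]
    refine tsum_congr fun n => ?_
    have hre : 0 ≤ (((n + 1 : ℕ) : ℂ) * α).re := by
      rw [← Complex.ofReal_natCast, Complex.re_ofReal_mul]
      positivity
    have hne : ((n + 1 : ℕ) : ℂ) * α + 1 ≠ 0 := fun h0 => by
      have := congrArg Complex.re h0
      rw [Complex.add_re, Complex.one_re, Complex.zero_re] at this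
      linarith
    have hterm : ∀ t : ℝ, c n * (z * (t : ℂ) ^ α) ^ (n + 1) =
        c n * z ^ (n + 1) * (t : ℂ) ^ (((n + 1 : ℕ) : ℂ) * α) := fun t => by
      rw [Complex.cpow_nat_mul]; ring
    simp only [hterm]
    rw [intervalIntegral.integral_const_mul, integral_cpow (Or.inl (by linarith)),
      Complex.ofReal_one, Complex.one_cpow, Complex.ofReal_zero, Complex.zero_cpow hne]
    push_cast at hne ⊢
    rw [add_comm _ (1 : ℂ)] at hne ⊢
    ring
  · intro n
    rw [uIoc_of_le zero_le_one]
    exact (continuousOn_const.mul ((continuousOn_const.mul continuousOn_ofReal_cpow).pow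
      (n + 1))).aestronglyMeasurable measurableSet_Ioc
  · refine fun n => Eventually.of_forall fun t ht => ?_
    rw [uIoc_of_le zero_le_one] at ht
    rw [norm_mul, norm_mul, norm_pow, norm_pow]
    gcongr
    exact norm_mul_ofReal_cpow_le hα z ht
  · exact Eventually.of_forall fun t _ => (hc z hz).norm
  · exact intervalIntegrable_const
  · refine Eventually.of_forall fun t ht => ?_
    rw [uIoc_of_le zero_le_one] at ht
    rw [hsum _ (hmem t ht), add_sub_cancel_left]
    exact (hc _ (hmem t ht)).hasSum

end PowerKernel

theorem exists_subordination_div_id {α : ℂ} (hα : 0 ≤ α.re) {φ f w : ℂ → ℂ}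
    (hφ : IsConvexOnDisc φ) (hf : DifferentiableOn ℂ f (ball 0 1)) (hf0 : f 0 = 0)
    (hw : DifferentiableOn ℂ w (ball 0 1)) (hw0 : w 0 = 0)
    (hw1 : ∀ z ∈ ball (0 : ℂ) 1, ‖w z‖ < 1)
    (hode : ∀ z ∈ ball (0 : ℂ) 1, deriv f z + α * z * deriv (deriv f) z = φ (w z)) :
    ∃ ω : ℂ → ℂ, DifferentiableOn ℂ ω (ball 0 1) ∧ ω 0 = 0 ∧
      (∀ z ∈ ball (0 : ℂ) 1, ‖ω z‖ < 1) ∧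
      ∀ z ∈ ball (0 : ℂ) 1, z ≠ 0 →
        f z / z = ∫ σ in (0 : ℝ)..1, ∫ ζ in (0 : ℝ)..1, φ (ω z * σ * (ζ : ℂ) ^ α) := by
  have hone : (0 : ℝ) ≤ (1 : ℂ).re := by simp
  have hQ := differentiableOn_integral_comp_mul_cpow hα hφ.differentiableOn
  obtain ⟨ω₁, hω₁, hω₁0, hω₁1, hderiv⟩ := exists_subordination_of_euler hα hφ hQ
    (fun z hz => euler_integral_comp_mul_cpow hα hφ.differentiableOn hz)
    (hf.deriv isOpen_ball) hw hw0 hw1 hode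
  have hQc := hφ.of_euler hα hQ fun z hz => euler_integral_comp_mul_cpow hα hφ.differentiableOn hz
  have hball : ball (0 : ℂ) 1 ∈ 𝓝 0 := ball_mem_nhds 0 one_pos
  have hg : DifferentiableOn ℂ (dslope f 0) (ball 0 1) :=
    (Complex.differentiableOn_dslope hball).2 hf
  have hfg : ∀ z, z * dslope f 0 z = f z := fun z => by
    simpa [hf0] using sub_smul_dslope f 0 z
  have hgode : ∀ z ∈ ball (0 : ℂ) 1, dslope f 0 z + 1 * z * deriv (dslope f 0) z =
      ∫ ζ in (0 : ℝ)..1, φ (ω₁ z * (ζ : ℂ) ^ α) := fun z hz => by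
    rw [← hderiv z hz]
    have h1 := (hasDerivAt_id z).mul (hasDerivAt_of_differentiableOn_ball hg hz)
    have h2 : HasDerivAt f (1 * dslope f 0 z + z * deriv (dslope f 0) z) z :=
      h1.congr_of_eventuallyEq (Eventually.of_forall fun x => (hfg x).symm)
    rw [h2.deriv]
    ring
  obtain ⟨ω, hω, hω0, hω1, hgω⟩ := exists_subordination_of_euler hone hQc
    (differentiableOn_integral_comp_mul_cpow hone hQ)
    (fun z hz => euler_integral_comp_mul_cpow hone hQ hz) hg hω₁ hω₁0 hω₁1 hgode
  refine ⟨ω, hω, hω0, hω1, fun z hz hz0 => ?_⟩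
  have := hgω z hz
  simp only [Complex.cpow_one] at this
  rw [← this, ← hfg z, mul_div_cancel_left₀ _ hz0]

theorem double_integral_comp_mul_cpow_eq_tsum {α : ℂ} (hα : 0 ≤ α.re) {φ : ℂ → ℂ}
    (hφ : DifferentiableOn ℂ φ (ball 0 1)) {c : ℕ → ℂ}
    (hc : ∀ z ∈ ball (0 : ℂ) 1, Summable fun n => c n * z ^ (n + 1))
    (hsum : ∀ z ∈ ball (0 : ℂ) 1, φ z = 1 + ∑' n, c n * z ^ (n + 1)) {z : ℂ}
    (hz : z ∈ ball (0 : ℂ) 1) :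
    ∫ σ in (0 : ℝ)..1, ∫ ζ in (0 : ℝ)..1, φ (z * σ * (ζ : ℂ) ^ α) =
      1 + ∑' n : ℕ, c n * z ^ (n + 1) / (((n : ℂ) + 2) * (1 + ((n : ℂ) + 1) * α)) := by
  have hQ := differentiableOn_integral_comp_mul_cpow hα hφ
  have hnorm : ∀ n : ℕ, 1 ≤ ‖1 + ((n : ℂ) + 1) * α‖ := fun n => by
    refine le_trans ?_ (Complex.re_le_norm _)
    have : 0 ≤ ((n : ℝ) + 1) * α.re := by positivity
    simpa using this
  have hc' : ∀ z ∈ ball (0 : ℂ) 1,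
      Summable fun n : ℕ => c n / (1 + ((n : ℂ) + 1) * α) * z ^ (n + 1) := fun z hz => by
    refine Summable.of_norm_bounded (hc z hz).norm fun n => ?_
    rw [norm_mul, norm_mul, norm_div]
    gcongr
    exact div_le_self (norm_nonneg _) (hnorm n)
  have := integral_comp_mul_cpow_eq_tsum (α := 1) (by simp) hQ.continuousOn hc'
    (fun z hz => integral_comp_mul_cpow_eq_tsum hα hφ.continuousOn hc hsum hz) hz
  simp only [Complex.cpow_one] at this
  rw [this]
  congr 1
  refine tsum_congr fun n => ?_
  rw [div_div, div_mul_eq_mul_div]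
  congr 1
  ring

end ConvexSubordination

/-- If `f' + α z f'' ≺ φ` with `φ` convex, symmetric, `Re α ≥ 0`, then
`f(z)/z ≺ ∫₀¹∫₀¹ φ(z σ ζ^α) dσ dζ`, and for real `α` this double integral equals
`1 + ∑_{n≥1} B n z^n / ((n+1)(1+nα))`. -/
theorem growth_subordination_double_integral (α : ℂ) (hα : 0 ≤ α.re)
    (φ f : ℂ → ℂ) (B : ℕ → ℝ) (a : ℕ → ℂ)
    (hB1 : 0 < B 1)
    (hφ : DifferentiableOn ℂ φ (ball 0 1))
    (hφ0 : φ 0 = 1)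
    (hφc : ∀ z ∈ ball (0:ℂ) 1, φ z = 1 + ∑' n : ℕ, (B (n + 1) : ℂ) * z ^ (n + 1))
    (hφconv : Convex ℝ (φ '' ball 0 1))
    (hφinj : Set.InjOn φ (ball 0 1))
    (hφsym : ∀ z ∈ ball (0:ℂ) 1, φ (starRingEnd ℂ z) = starRingEnd ℂ (φ z))
    (hf : DifferentiableOn ℂ f (ball 0 1))
    (hfa : ∀ z ∈ ball (0:ℂ) 1, f z = z + ∑' n : ℕ, a (n + 2) * z ^ (n + 2))
    (hsub : ∃ w : ℂ → ℂ, DifferentiableOn ℂ w (ball 0 1) ∧ w 0 = 0 ∧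
      (∀ z ∈ ball (0:ℂ) 1, ‖w z‖ < 1) ∧
      ∀ z ∈ ball (0:ℂ) 1, deriv f z + α * z * deriv (deriv f) z = φ (w z)) :
    (∃ ω : ℂ → ℂ, DifferentiableOn ℂ ω (ball 0 1) ∧ ω 0 = 0 ∧
      (∀ z ∈ ball (0:ℂ) 1, ‖ω z‖ < 1) ∧
      ∀ z ∈ ball (0:ℂ) 1, z ≠ 0 →
        f z / z = ∫ σ in (0:ℝ)..1, ∫ ζ in (0:ℝ)..1, φ (ω z * σ * (ζ : ℂ) ^ α)) ∧
    (α.im = 0 → ∀ z ∈ ball (0:ℂ) 1,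
      (∫ σ in (0:ℝ)..1, ∫ ζ in (0:ℝ)..1, φ (z * σ * (ζ : ℂ) ^ α))
        = 1 + ∑' n : ℕ, (B (n + 1) : ℂ) * z ^ (n + 1)
            / (((n : ℂ) + 2) * (1 + ((n : ℂ) + 1) * α))) := by
  refine ⟨?_, fun _ z hz => ?_⟩
  · obtain ⟨w, hw, hw0, hw1, hode⟩ := hsub
    exact exists_subordination_div_id hα (isConvexOnDisc_of_convex_image hφ hφconv hφinj) hf
      (by simpa using hfa 0 (mem_ball_self one_pos)) hw hw0 hw1 hode
  · refine double_integral_comp_mul_cpow_eq_tsum hα hφ (c := fun n => (B (n + 1) : ℂ))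
      (fun x hx => ?_) hφc hz
    by_contra hns
    -- where the series diverges its junk sum is `0`, so injectivity forces `x = 0`
    have hx0 : x = 0 := hφinj hx (mem_ball_self one_pos) <| by
      rw [hφ0, hφc x hx, tsum_eq_zero_of_not_summable hns, add_zero]
    exact hns (by simp [hx0, summable_zero])
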